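/- (Proposition 1) Let Ω ⊆ ℝ³ be open, φ : Ω → ℂ twice differentiable and nowhere vanishing, and set v = Δφ/φ and α = (Dφ)/φ = (grad φ)/φ (a pure quaternion-valued function on Ω). Let ψ : Ω → ℂ be twice differentiable with -Δψ + vψ = 0 on Ω. Then the ℍ(ℂ)-valued function f = (D - α)ψ = Dψ - ψα satisfies the equation Df + f·α = 0 on Ω, i.e., (D + M^α)f = 0. -/

import Mathlib

noncomputable section

/-- Partial derivative `∂ₖ` of a complex-valued function on `ℝ³`. -/
def pd (k : Fin 3) (g : (Fin 3 → ℝ) → ℂ) (x : Fin 3 → ℝ) : ℂ :=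
  fderiv ℝ g x (Pi.single k 1)

/-- Embedding of a vector in `ℂ³` as a pure (vector-part) complex quaternion
`v₁i₁ + v₂i₂ + v₃i₃`. -/
def vecQ (v : Fin 3 → ℂ) : Quaternion ℂ := ⟨0, v 0, v 1, v 2⟩

/-- Componentwise partial derivative of an `ℍ(ℂ)`-valued function. -/
def pdQ (k : Fin 3) (f : (Fin 3 → ℝ) → Quaternion ℂ) (x : Fin 3 → ℝ) : Quaternion ℂ :=
  ⟨pd k (fun y => (f y).re) x, pd k (fun y => (f y).imI) x,
   pd k (fun y => (f y).imJ) x, pd k (fun y => (f y).imK) x⟩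

/-- The Moisil–Theodoresco operator `Df = i₁∂₁f + i₂∂₂f + i₃∂₃f`. -/
def Dq (f : (Fin 3 → ℝ) → Quaternion ℂ) (x : Fin 3 → ℝ) : Quaternion ℂ :=
  vecQ ![1,0,0] * pdQ 0 f x + vecQ ![0,1,0] * pdQ 1 f x + vecQ ![0,0,1] * pdQ 2 f x

/-- Differentiability at a point of an `ℍ(ℂ)`-valued function (componentwise). -/
def QDiffAt (f : (Fin 3 → ℝ) → Quaternion ℂ) (x : Fin 3 → ℝ) : Prop :=
  DifferentiableAt ℝ (fun y => (f y).re) x ∧ DifferentiableAt ℝ (fun y => (f y).imI) x ∧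
  DifferentiableAt ℝ (fun y => (f y).imJ) x ∧ DifferentiableAt ℝ (fun y => (f y).imK) x

/-- Differentiability at a point of a `ℂ³`-valued function (componentwise). -/
def VDiffAt (g : (Fin 3 → ℝ) → Fin 3 → ℂ) (x : Fin 3 → ℝ) : Prop :=
  ∀ k : Fin 3, DifferentiableAt ℝ (fun y => g y k) x

/-- Divergence of a `ℂ³`-valued function. -/
def divg (g : (Fin 3 → ℝ) → Fin 3 → ℂ) (x : Fin 3 → ℝ) : ℂ :=
  ∑ k : Fin 3, pd k (fun y => g y k) x

/-- Gradient of a `ℂ`-valued function. -/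
def gradg (h : (Fin 3 → ℝ) → ℂ) (x : Fin 3 → ℝ) : Fin 3 → ℂ := fun k => pd k h x

/-- Curl (rotor) of a `ℂ³`-valued function. -/
def rotg (g : (Fin 3 → ℝ) → Fin 3 → ℂ) (x : Fin 3 → ℝ) : Fin 3 → ℂ :=
  ![pd 1 (fun y => g y 2) x - pd 2 (fun y => g y 1) x,
    pd 2 (fun y => g y 0) x - pd 0 (fun y => g y 2) x,
    pd 0 (fun y => g y 1) x - pd 1 (fun y => g y 0) x]

/-- Complex-bilinear scalar product on `ℂ³`. -/
def dotC (p q : Fin 3 → ℂ) : ℂ := ∑ k : Fin 3, p k * q k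

/-- Cross product on `ℂ³`. -/
def crossC (p q : Fin 3 → ℂ) : Fin 3 → ℂ :=
  ![p 1 * q 2 - p 2 * q 1, p 2 * q 0 - p 0 * q 2, p 0 * q 1 - p 1 * q 0]

/-- Laplacian of a `ℂ`-valued function. -/
def lap (h : (Fin 3 → ℝ) → ℂ) (x : Fin 3 → ℝ) : ℂ :=
  ∑ k : Fin 3, pd k (fun y => pd k h y) x

theorem fderiv_eq_sum_pd (g : (Fin 3 → ℝ) → ℂ) (y : Fin 3 → ℝ) :
    fderiv ℝ g y = ∑ k : Fin 3,
      (ContinuousLinearMap.proj (R := ℝ) (φ := fun _ : Fin 3 => ℝ) k).smulRight (pd k g y) := by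
  ext v
  conv_lhs => rw [pi_eq_sum_univ' v]
  simp [pd, map_sum]

theorem differentiableAt_fderiv_of_pd {g : (Fin 3 → ℝ) → ℂ} {x : Fin 3 → ℝ}
    (h : ∀ k, DifferentiableAt ℝ (fun y => pd k g y) x) :
    DifferentiableAt ℝ (fderiv ℝ g) x := by
  rw [funext (fderiv_eq_sum_pd g)]
  refine DifferentiableAt.fun_sum fun k _ => ?_
  exact ((ContinuousLinearMap.smulRightL ℝ (Fin 3 → ℝ) ℂ
    (ContinuousLinearMap.proj k)).differentiableAt).comp x (h k)

theorem pd_pd_comm {g : (Fin 3 → ℝ) → ℂ} {x : Fin 3 → ℝ}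
    (hg : ∀ᶠ y in nhds x, DifferentiableAt ℝ g y)
    (h : ∀ k, DifferentiableAt ℝ (fun y => pd k g y) x) (j k : Fin 3) :
    pd j (fun y => pd k g y) x = pd k (fun y => pd j g y) x := by
  have hd := differentiableAt_fderiv_of_pd h
  have key : ∀ j k : Fin 3, pd j (fun y => pd k g y) x =
      fderiv ℝ (fderiv ℝ g) x (Pi.single j 1) (Pi.single k 1) := by
    intro j k
    have := (hd.hasFDerivAt.clm_apply (hasFDerivAt_const (Pi.single k (1 : ℝ)) x)).fderiv
    simp only [pd]
    rw [this]
    simp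
  rw [key, key]
  exact second_derivative_symmetric_of_eventually
    (hg.mono fun y hy => hy.hasFDerivAt) hd.hasFDerivAt _ _

theorem pd_sub_mul_div {p u q w : (Fin 3 → ℝ) → ℂ} {x : Fin 3 → ℝ}
    (hp : DifferentiableAt ℝ p x) (hu : DifferentiableAt ℝ u x)
    (hq : DifferentiableAt ℝ q x) (hw : DifferentiableAt ℝ w x) (h0 : w x ≠ 0) (j : Fin 3) :
    pd j (fun y => p y - u y * (q y / w y)) x =
      pd j p x - (pd j u x * (q x / w x)
        + u x * ((pd j q x * w x - q x * pd j w x) / w x ^ 2)) := by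
  have := (hp.hasFDerivAt.sub (hu.hasFDerivAt.mul
    (hq.hasFDerivAt.mul ((hasFDerivAt_inv h0).restrictScalars ℝ |>.comp x hw.hasFDerivAt)))).fderiv
  have e : (fun y => p y - u y * (q y / w y)) = p - u * (q * (Inv.inv ∘ w)) := by
    ext y; simp [div_eq_mul_inv]
  simp only [pd]
  rw [e, this]
  simp
  field_simp
  ring

@[simp] theorem re_vecQ (v : Fin 3 → ℂ) : (vecQ v).re = 0 := rfl

@[simp] theorem imI_vecQ (v : Fin 3 → ℂ) : (vecQ v).imI = v 0 := rfl

@[simp] theorem imJ_vecQ (v : Fin 3 → ℂ) : (vecQ v).imJ = v 1 := rfl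

@[simp] theorem imK_vecQ (v : Fin 3 → ℂ) : (vecQ v).imK = v 2 := rfl

@[simp] theorem re_pdQ (k : Fin 3) (f : (Fin 3 → ℝ) → Quaternion ℂ) (x : Fin 3 → ℝ) :
    (pdQ k f x).re = pd k (fun y => (f y).re) x := rfl

@[simp] theorem imI_pdQ (k : Fin 3) (f : (Fin 3 → ℝ) → Quaternion ℂ) (x : Fin 3 → ℝ) :
    (pdQ k f x).imI = pd k (fun y => (f y).imI) x := rfl

@[simp] theorem imJ_pdQ (k : Fin 3) (f : (Fin 3 → ℝ) → Quaternion ℂ) (x : Fin 3 → ℝ) :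
    (pdQ k f x).imJ = pd k (fun y => (f y).imJ) x := rfl

@[simp] theorem imK_pdQ (k : Fin 3) (f : (Fin 3 → ℝ) → Quaternion ℂ) (x : Fin 3 → ℝ) :
    (pdQ k f x).imK = pd k (fun y => (f y).imK) x := rfl

/-- (Proposition 1) With `v = Δφ/φ` and `α = (grad φ)/φ` for twice differentiable
nowhere-vanishing `φ`, if `ψ` solves the Schrödinger equation `-Δψ + vψ = 0` on `Ω`,
then `f = (D - α)ψ = Dψ - ψα` solves `(D + Mᵅ)f = Df + f·α = 0` on `Ω`. -/
theorem darboux_type_solution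
    (Ω : Set (Fin 3 → ℝ)) (hΩ : IsOpen Ω) (φ ψ : (Fin 3 → ℝ) → ℂ)
    (hφ : ∀ x ∈ Ω, DifferentiableAt ℝ φ x)
    (hφ' : ∀ k : Fin 3, ∀ x ∈ Ω, DifferentiableAt ℝ (fun y => pd k φ y) x)
    (hφ0 : ∀ x ∈ Ω, φ x ≠ 0)
    (hψ : ∀ x ∈ Ω, DifferentiableAt ℝ ψ x)
    (hψ' : ∀ k : Fin 3, ∀ x ∈ Ω, DifferentiableAt ℝ (fun y => pd k ψ y) x)
    (hSchr : ∀ x ∈ Ω, -lap ψ x + (lap φ x / φ x) * ψ x = 0) :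
    ∀ x ∈ Ω,
      Dq (fun y => vecQ (fun k => pd k ψ y)
            - (ψ y : Quaternion ℂ) * vecQ (fun k => pd k φ y / φ y)) x
          + (vecQ (fun k => pd k ψ x)
              - (ψ x : Quaternion ℂ) * vecQ (fun k => pd k φ x / φ x))
            * vecQ (fun k => pd k φ x / φ x)
        = 0 := by
  intro x hx
  have hev : ∀ᶠ y in nhds x, y ∈ Ω := hΩ.mem_nhds hx
  have cφ := pd_pd_comm (hev.mono hφ) (fun k => hφ' k x hx)
  have cψ := pd_pd_comm (hev.mono hψ) (fun k => hψ' k x hx)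
  have h0 := hφ0 x hx
  have hS := hSchr x hx
  have hpd : ∀ j k : Fin 3, pd j (fun y => pd k ψ y - ψ y * (pd k φ y / φ y)) x = _ :=
    fun j k => pd_sub_mul_div (hψ' k x hx) (hψ x hx) (hφ' k x hx) (hφ x hx) h0 j
  have hz : ∀ j : Fin 3, pd j (fun _ => (0 : ℂ)) x = 0 := fun j => by simp [pd]
  simp only [lap, Fin.sum_univ_three] at hS
  have φ01 := cφ 1 0
  have φ02 := cφ 2 0
  have φ12 := cφ 2 1
  have ψ01 := cψ 1 0
  have ψ02 := cψ 2 0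
  have ψ12 := cψ 2 1
  apply Quaternion.ext <;> refine Eq.trans (b := (0 : ℂ)) ?_ rfl <;> simp [Dq, hpd, hz]
  · field_simp at hS ⊢
    linear_combination φ x * hS
  · rw [φ12, ψ12]; field_simp; ring
  · rw [φ02, ψ02]; field_simp; ring
  · rw [φ01, ψ01]; field_simp; ring
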